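/- Let J and D be additive abelian groups, let π : J →+ D, p : D →+ J and ι : D →+ D be group homomorphisms, let ε ∈ J, and let g ≥ 1 be a natural number. Assume: (i) p(π(θ)) = 2θ for every θ ∈ J; (ii) ι(π(θ)) = π(θ) for every θ ∈ J; (iii) the kernel of π is exactly {0, ε} and ε ≠ 0; (iv) the 2-torsion subgroup J[2] = {θ ∈ J : 2θ = 0} is finite of cardinality 2^(2g); (v) the set {x ∈ D : p(x) = 0 and ι(x) = x} is finite of cardinality 2^(2g−1). Let P be a subgroup of D such that p(x) = 0 and ι(x) = −x for every x ∈ P. Then every 2-torsion element of P lies in π(J[2]): for every x ∈ P with 2x = 0 there exists θ ∈ J with 2θ = 0 and π(θ) = x. -/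

import Mathlib

theorem stmt1 {J D : Type*} [AddCommGroup J] [AddCommGroup D]
    (π : J →+ D) (p : D →+ J) (ι : D →+ D) (ε : J) (g : ℕ) (hg : 1 ≤ g)
    (h1 : ∀ θ : J, p (π θ) = 2 • θ)
    (h2 : ∀ θ : J, ι (π θ) = π θ)
    (h3 : {x : J | π x = 0} = {0, ε}) (hε : ε ≠ 0)
    (h4fin : {θ : J | 2 • θ = 0}.Finite)
    (h4 : {θ : J | 2 • θ = 0}.ncard = 2 ^ (2 * g))
    (h5fin : {x : D | p x = 0 ∧ ι x = x}.Finite)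
    (h5 : {x : D | p x = 0 ∧ ι x = x}.ncard = 2 ^ (2 * g - 1))
    (P : AddSubgroup D) (hP : ∀ x ∈ P, p x = 0 ∧ ι x = -x) :
    ∀ x ∈ P, 2 • x = 0 → ∃ θ : J, 2 • θ = 0 ∧ π θ = x := by
  classical
  set T : Finset J := h4fin.toFinset with hT
  set S : Finset D := h5fin.toFinset with hS
  have hTcard : T.card = 2 ^ (2 * g) := by
    rw [← h4, Set.ncard_eq_toFinset_card _ h4fin]
  have hScard : S.card = 2 ^ (2 * g - 1) := by
    rw [← h5, Set.ncard_eq_toFinset_card _ h5fin]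
  have hsub : T.image π ⊆ S := by
    intro y hy
    obtain ⟨θ, hθ, rfl⟩ := Finset.mem_image.1 hy
    have hθ' : 2 • θ = 0 := by simpa [hT] using hθ
    simp [hS, h1, h2, hθ']
  have hfiber : T.card ≤ 2 * (T.image π).card := by
    refine Finset.card_le_mul_card_image T 2 fun y hy => ?_
    obtain ⟨θ, -, rfl⟩ := Finset.mem_image.1 hy
    refine (Finset.card_le_card (t := {θ, θ + ε}) fun η hη => ?_).trans Finset.card_le_two
    have hker : η - θ ∈ {x : J | π x = 0} := by
      simp [(Finset.mem_filter.1 hη).2]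
    rw [h3] at hker
    rcases hker with h | h
    · simp [sub_eq_zero.1 h]
    · simp [← Set.mem_singleton_iff.1 h]
  have hpow : 2 ^ (2 * g) = 2 * 2 ^ (2 * g - 1) := by
    rw [← pow_succ']
    congr 1
    omega
  have himage : T.image π = S := Finset.eq_of_subset_of_card_le hsub (by omega)
  intro x hx h2x
  obtain ⟨hpx, hιx⟩ := hP x hx
  have hneg : -x = x := neg_eq_of_add_eq_zero_left (by rwa [← two_nsmul])
  have hxS : x ∈ S := by simp [hS, hpx, hιx, hneg]
  rw [← himage] at hxS
  obtain ⟨θ, hθ, hπθ⟩ := Finset.mem_image.1 hxS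
  exact ⟨θ, by simpa [hT] using hθ, hπθ⟩
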